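/- Let f(t) = Σ_{k=1}^∞ p_k e^{i⟨t,x_k⟩} with p_k ≥ 0, Σ p_k = 1, x_k ∈ ℝ^d. If for some c = (c^{(1)},…,c^{(d)}) ∈ ℝ^d and μ_c > 0 we have |f(c^{(1)}t,…,c^{(d)}t)| ≥ μ_c for all t ∈ ℝ, where the coordinates of the support points expand in ℤ-bases (β^{(j)}_l) with {c^{(j)}β^{(j)}_l} jointly ℤ-linearly independent, then inf_{t∈ℝ^d} |f(t)| > 0. -/

import Mathlib

open scoped RealInnerProductSpace

open MeasureTheory Filter Topology

/-- The one-parameter flow on the torus with direction `a`. -/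
noncomputable def kflow {ι : Type*} (a : ι → ℝ) (s : ℝ) : ι → UnitAddCircle :=
  fun i => ((s * a i : ℝ) : UnitAddCircle)

lemma kflow_continuous {ι : Type*} (a : ι → ℝ) : Continuous (kflow a) := by
  refine continuous_pi fun i => ?_
  exact (AddCircle.continuous_mk' 1).comp (continuous_id.mul continuous_const)

lemma kflow_mFourier {ι : Type*} [Fintype ι] (a : ι → ℝ) (n : ι → ℤ) (s : ℝ) :
    UnitAddTorus.mFourier n (kflow a s) =
      Complex.exp ((2 * Real.pi * Complex.I * ((∑ i, (n i : ℝ) * a i : ℝ) : ℂ)) * s) := by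
  simp only [UnitAddTorus.mFourier, ContinuousMap.coe_mk, kflow, fourier_coe_apply]
  rw [← Complex.exp_sum]
  congr 1
  push_cast
  rw [Finset.mul_sum, Finset.sum_mul]
  refine Finset.sum_congr rfl fun i _ => ?_
  ring

lemma integral_fourier_zero (n : ℤ) (hn : n ≠ 0) :
    ∫ y, fourier n y ∂(AddCircle.haarAddCircle (T := (1 : ℝ))) = 0 :=
  integral_eq_zero_of_add_right_eq_neg (μ := AddCircle.haarAddCircle)
    (fourier_add_half_inv_index hn one_pos)

lemma mean_tendsto {ι : Type*} [Fintype ι] (a : ι → ℝ) (ha : LinearIndependent ℤ a)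
    (φ : C(ι → UnitAddCircle, ℂ)) :
    Tendsto (fun T : ℝ => (T : ℂ)⁻¹ * ∫ s in (0 : ℝ)..T, φ (kflow a s)) atTop
      (𝓝 (∫ y, φ y ∂(Measure.pi fun _ : ι => AddCircle.haarAddCircle (T := (1 : ℝ))))) := by
  have hint : ∀ (g : C(ι → UnitAddCircle, ℂ)) (u v : ℝ),
      IntervalIntegrable (fun s => g (kflow a s)) volume u v := fun g u v =>
    (g.continuous.comp (kflow_continuous a)).intervalIntegrable u v
  have hint2 : ∀ (g : C(ι → UnitAddCircle, ℂ)),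
      Integrable g (Measure.pi fun _ : ι => AddCircle.haarAddCircle (T := (1 : ℝ))) := fun g =>
    g.continuous.integrable_of_hasCompactSupport (HasCompactSupport.of_compactSpace _)
  have hspan : ∀ g ∈ Submodule.span ℂ (Set.range (UnitAddTorus.mFourier (d := ι))),
      Tendsto (fun T : ℝ => (T : ℂ)⁻¹ * ∫ s in (0 : ℝ)..T, g (kflow a s)) atTop
      (𝓝 (∫ y, g y ∂(Measure.pi fun _ : ι => AddCircle.haarAddCircle (T := (1 : ℝ))))) := by
    intro g hg
    induction hg using Submodule.span_induction with
    | mem g hg =>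
      obtain ⟨n, rfl⟩ := hg
      by_cases hn : n = 0
      · subst hn
        rw [UnitAddTorus.mFourier_zero]
        simp only [ContinuousMap.one_apply, intervalIntegral.integral_const, integral_const]
        simp only [sub_zero, probReal_univ, one_smul, Complex.real_smul, mul_one]
        refine tendsto_const_nhds.congr' ?_
        filter_upwards [eventually_gt_atTop 0] with T hT
        rw [inv_mul_cancel₀]
        exact_mod_cast hT.ne'
      · have h0 : ∫ y, UnitAddTorus.mFourier n y
            ∂(Measure.pi fun _ : ι => AddCircle.haarAddCircle (T := (1 : ℝ))) = 0 := by
          simp only [UnitAddTorus.mFourier, ContinuousMap.coe_mk]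
          have := integral_fintype_prod_eq_prod (𝕜 := ℂ) 
            (μ := fun _ : ι => AddCircle.haarAddCircle (T := (1 : ℝ)))
            (fun i (y : UnitAddCircle) => fourier (n i) y)
          refine this.trans ?_
          obtain ⟨i, hi⟩ := Function.ne_iff.mp hn
          exact Finset.prod_eq_zero (Finset.mem_univ i) (integral_fourier_zero _ hi)
        rw [h0]
        simp only [kflow_mFourier]
        set r : ℝ := ∑ i, (n i : ℝ) * a i with hr
        have hr0 : r ≠ 0 := by
          intro h
          apply hn
          funext i
          refine Fintype.linearIndependent_iff.mp ha n ?_ i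
          simpa [hr] using h
        have hC : (2 * Real.pi * Complex.I * (r : ℂ)) ≠ 0 := by
          simp [hr0, Real.pi_ne_zero]
        simp only [integral_exp_mul_complex hC]
        rw [tendsto_zero_iff_norm_tendsto_zero]
        have hb : Tendsto (fun T : ℝ => T⁻¹ * (2 / ‖2 * Real.pi * Complex.I * (r : ℂ)‖)) atTop
            (𝓝 0) := by
          simpa using tendsto_inv_atTop_zero.mul_const (2 / ‖2 * Real.pi * Complex.I * (r : ℂ)‖)
        refine squeeze_zero' (Eventually.of_forall fun _ => norm_nonneg _) ?_ hb
        filter_upwards [eventually_gt_atTop 0] with T hT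
        rw [norm_mul, norm_div, norm_inv, Complex.norm_real, Real.norm_of_nonneg hT.le]
        gcongr
        refine (norm_sub_le _ _).trans ?_
        have : ∀ s : ℝ, ‖Complex.exp (2 * Real.pi * Complex.I * (r : ℂ) * s)‖ = 1 := by
          intro s
          rw [show (2 * Real.pi * Complex.I * (r : ℂ) * s) = ((2 * Real.pi * r * s : ℝ) : ℂ) * Complex.I
            by push_cast; ring]
          exact Complex.norm_exp_ofReal_mul_I _
        rw [this, this]
        norm_num
    | zero => simp
    | add g h _ _ ihg ihh =>
      simp only [ContinuousMap.add_apply]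
      rw [integral_add (hint2 g) (hint2 h)]
      refine (ihg.add ihh).congr fun T => ?_
      rw [intervalIntegral.integral_add (hint g _ _) (hint h _ _)]
      ring
    | smul c g _ ih =>
      simp only [ContinuousMap.smul_apply, smul_eq_mul]
      rw [integral_const_mul]
      refine (ih.const_mul c).congr fun T => ?_
      rw [intervalIntegral.integral_const_mul]
      ring
  rw [Metric.tendsto_atTop']
  intro ε hε
  have hmem : φ ∈ closure (Submodule.span ℂ (Set.range (UnitAddTorus.mFourier (d := ι))) :
      Set C(ι → UnitAddCircle, ℂ)) := by
    rw [← Submodule.topologicalClosure_coe, UnitAddTorus.span_mFourier_closure_eq_top]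
    trivial
  obtain ⟨g, hg, hd⟩ := Metric.mem_closure_iff.mp hmem (ε / 3) (by positivity)
  obtain ⟨N, hN⟩ := (Metric.tendsto_atTop'.mp (hspan g hg)) (ε / 3) (by positivity)
  have hpt : ∀ y, ‖φ y - g y‖ ≤ ε / 3 := fun y => by
    rw [← dist_eq_norm]
    exact (ContinuousMap.dist_apply_le_dist y).trans hd.le
  refine ⟨max N 0, fun T hT => ?_⟩
  have hT0 : 0 < T := (le_max_right _ _).trans_lt hT
  have h2 := hN T ((le_max_left _ _).trans_lt hT)
  have h1 : dist ((T : ℂ)⁻¹ * ∫ s in (0 : ℝ)..T, φ (kflow a s))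
      ((T : ℂ)⁻¹ * ∫ s in (0 : ℝ)..T, g (kflow a s)) ≤ ε / 3 := by
    rw [dist_eq_norm, ← mul_sub, ← intervalIntegral.integral_sub (hint φ _ _) (hint g _ _),
      norm_mul, norm_inv, Complex.norm_real, Real.norm_of_nonneg hT0.le]
    have := intervalIntegral.norm_integral_le_of_norm_le_const (a := (0 : ℝ)) (b := T)
      (f := fun s => φ (kflow a s) - g (kflow a s)) (C := ε / 3) (fun s _ => hpt _)
    rw [sub_zero, abs_of_pos hT0] at this
    rw [inv_mul_le_iff₀ hT0]
    linarith
  have h3 : dist (∫ y, g y ∂(Measure.pi fun _ : ι => AddCircle.haarAddCircle (T := (1 : ℝ))))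
      (∫ y, φ y ∂(Measure.pi fun _ : ι => AddCircle.haarAddCircle (T := (1 : ℝ)))) ≤ ε / 3 := by
    rw [dist_comm, dist_eq_norm, ← integral_sub (hint2 φ) (hint2 g)]
    have := norm_integral_le_of_norm_le_const
      (μ := Measure.pi fun _ : ι => AddCircle.haarAddCircle (T := (1 : ℝ)))
      (f := fun y => φ y - g y) (C := ε / 3) (Eventually.of_forall hpt)
    simpa using this
  have := dist_triangle4 ((T : ℂ)⁻¹ * ∫ s in (0 : ℝ)..T, φ (kflow a s))
    ((T : ℂ)⁻¹ * ∫ s in (0 : ℝ)..T, g (kflow a s))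
    (∫ y, g y ∂(Measure.pi fun _ : ι => AddCircle.haarAddCircle (T := (1 : ℝ))))
    (∫ y, φ y ∂(Measure.pi fun _ : ι => AddCircle.haarAddCircle (T := (1 : ℝ))))
  linarith

lemma kronecker_fin {ι : Type*} [Fintype ι] (a : ι → ℝ) (ha : LinearIndependent ℤ a) :
    DenseRange (kflow a) := by
  intro θ
  rw [Metric.mem_closure_iff]
  by_contra! hcon
  obtain ⟨ε, hε, h⟩ := hcon
  let ψ : (ι → UnitAddCircle) → ℝ := fun y => max 0 (ε - dist θ y)
  have hψ : Continuous ψ := by fun_prop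
  let φ : C(ι → UnitAddCircle, ℂ) := ⟨fun y => (ψ y : ℂ), by fun_prop⟩
  have hm := mean_tendsto a ha φ
  have hz : ∀ s, φ (kflow a s) = 0 := fun s => by
    have := h _ ⟨s, rfl⟩
    simp [φ, ψ, this]
  simp only [hz, intervalIntegral.integral_zero, mul_zero] at hm
  have h0 := tendsto_nhds_unique hm tendsto_const_nhds
  have hpos : 0 < ∫ y, ψ y ∂(Measure.pi fun _ : ι => AddCircle.haarAddCircle (T := (1 : ℝ))) := by
    refine hψ.integral_pos_of_hasCompactSupport_nonneg_nonzero
      (HasCompactSupport.of_compactSpace _) (fun y => le_max_left _ _) (x := θ) ?_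
    simp [ψ, hε]
  have h1 : (∫ y, φ y ∂(Measure.pi fun _ : ι => AddCircle.haarAddCircle (T := (1 : ℝ)))) =
      ((∫ y, ψ y ∂(Measure.pi fun _ : ι => AddCircle.haarAddCircle (T := (1 : ℝ))) : ℝ) : ℂ) :=
    integral_ofReal
  rw [h1] at h0
  exact hpos.ne' (by exact_mod_cast h0)

lemma kronecker {ι : Type*} (a : ι → ℝ) (ha : LinearIndependent ℤ a) :
    DenseRange (kflow a) := by
  classical
  rw [DenseRange, dense_iff_inter_open]
  rintro U hU ⟨θ, hθ⟩
  obtain ⟨I, u, hu, hsub⟩ := isOpen_pi_iff.mp hU θ hθ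
  have hd := kronecker_fin (fun i : I => a i) (ha.comp _ Subtype.val_injective)
  obtain ⟨s, hs⟩ := hd.exists_mem_open
    (isOpen_set_pi (Set.finite_univ) (s := fun i : I => u i) (fun i _ => (hu i i.2).1))
    ⟨fun i => θ i, fun i _ => (hu i i.2).2⟩
  exact ⟨kflow a s, hsub fun i hi => hs ⟨i, hi⟩ trivial, s, rfl⟩

set_option maxHeartbeats 1000000 in
/-- If the characteristic function of a discrete law, restricted to the line
`t ↦ t·c` for a suitable direction `c` (making the scaled bases jointly
`ℤ`-linearly independent), is bounded away from zero, then it is bounded away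
from zero on all of `ℝ^d`. -/
theorem stmt15 (d : ℕ) (hd : 1 ≤ d)
    (p : ℕ → ℝ) (hp : ∀ k, 0 ≤ p k) (hpsum : Summable p) (hp1 : ∑' k, p k = 1)
    (x : ℕ → EuclideanSpace ℝ (Fin d)) (hx : Function.Injective x)
    (L : Fin d → Type) [∀ j, Countable (L j)]
    (β : ∀ j : Fin d, L j → ℝ) (hβ0 : ∀ j l, β j l ≠ 0)
    (hβind : ∀ j, LinearIndependent ℤ (β j))
    (z : ∀ j : Fin d, ℕ → (L j →₀ ℤ))
    (hxz : ∀ k j, x k j = (z j k).sum fun l m => (m : ℝ) * β j l)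
    (c : EuclideanSpace ℝ (Fin d)) (hc : ∀ j, c j ≠ 0)
    (hcind : LinearIndependent ℤ (fun q : Σ j : Fin d, L j => c q.1 * β q.1 q.2))
    (f : EuclideanSpace ℝ (Fin d) → ℂ)
    (hf : ∀ t, f t = ∑' k, (p k : ℂ) * Complex.exp (Complex.I * ((⟪t, x k⟫ : ℝ) : ℂ)))
    (μc : ℝ) (hμc : 0 < μc)
    (hline : ∀ t : ℝ, μc ≤ ‖f (t • c)‖) :
    ∃ μ : ℝ, 0 < μ ∧ ∀ t, μ ≤ ‖f t‖ := by
  classical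
  obtain ⟨χ, hχd⟩ : ∃ χ : ℕ → ((Σ j : Fin d, L j) → UnitAddCircle) → UnitAddCircle,
      ∀ k y, χ k y = ∑ j, ∑ l ∈ (z j k).support, (z j k l) • y ⟨j, l⟩ := ⟨_, fun _ _ => rfl⟩
  have hχ : ∀ k, Continuous (χ k) := fun k => by
    rw [funext (hχd k)]
    refine continuous_finsetSum _ fun j _ => continuous_finsetSum _ fun l _ => ?_
    exact (continuous_apply _).zsmul _
  obtain ⟨G, hGd⟩ : ∃ G : ((Σ j : Fin d, L j) → UnitAddCircle) → ℂ,
      ∀ y, G y = ∑' k, (p k : ℂ) * (AddCircle.toCircle (χ k y) : ℂ) := ⟨_, fun _ => rfl⟩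
  have hG : Continuous G := by
    rw [funext hGd]
    refine continuous_tsum (u := p) (fun k => ?_) hpsum (fun k y => ?_)
    · exact continuous_const.mul
        (continuous_subtype_val.comp (AddCircle.continuous_toCircle.comp (hχ k)))
    · rw [norm_mul, Complex.norm_real, Real.norm_of_nonneg (hp k), Circle.norm_coe, mul_one]
  have hfG : ∀ t : EuclideanSpace ℝ (Fin d),
      f t = G (fun q => ((t q.1 * β q.1 q.2 / (2 * Real.pi) : ℝ) : UnitAddCircle)) := by
    intro t
    rw [hf, hGd]
    refine tsum_congr fun k => ?_
    congr 1
    have h1 : χ k (fun q => ((t q.1 * β q.1 q.2 / (2 * Real.pi) : ℝ) : UnitAddCircle)) =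
        ((⟪t, x k⟫ / (2 * Real.pi) : ℝ) : UnitAddCircle) := by
      simp only [hχd, ← AddCircle.coe_zsmul]
      have hsum : ∀ (α : Type) (s : Finset α) (g : α → ℝ),
          ∑ i ∈ s, ((g i : ℝ) : UnitAddCircle) = ((∑ i ∈ s, g i : ℝ) : UnitAddCircle) :=
        fun α s g => (map_sum (QuotientAddGroup.mk' (AddSubgroup.zmultiples (1 : ℝ))) g s).symm
      simp only [hsum]
      congr 1
      rw [PiLp.inner_apply, Finset.sum_div]
      refine Finset.sum_congr rfl fun j _ => ?_
      rw [hxz, Finsupp.sum]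
      simp only [zsmul_eq_mul, RCLike.inner_apply, conj_trivial]
      rw [Finset.sum_mul, Finset.sum_div]
      refine Finset.sum_congr rfl fun l _ => ?_
      ring
    rw [h1, AddCircle.toCircle_apply_mk, Circle.coe_exp]
    congr 1
    rw [mul_comm]
    congr 2
    field_simp
  have hdense := kronecker _ hcind
  have hle : ∀ y, μc ≤ ‖G y‖ := by
    refine fun y => hdense.induction_on (p := fun y => μc ≤ ‖G y‖) y
      (isClosed_le continuous_const hG.norm) fun s => ?_
    have := hline ((2 * Real.pi * s))
    rw [hfG] at this
    have hq : (fun q : Σ j : Fin d, L j => ((((2 * Real.pi * s) • c) q.1 * β q.1 q.2 /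
        (2 * Real.pi) : ℝ) : UnitAddCircle)) =
        kflow (fun q : Σ j : Fin d, L j => c q.1 * β q.1 q.2) s := by
      funext q
      have hr : ((2 * Real.pi * s) • c) q.1 * β q.1 q.2 / (2 * Real.pi) =
          s * (c q.1 * β q.1 q.2) := by
        simp only [PiLp.smul_apply, smul_eq_mul]
        field_simp
      rw [hr, kflow]
    rwa [hq] at this
  exact ⟨μc, hμc, fun t => (hle _).trans_eq (congrArg norm (hfG t).symm)⟩
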